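/- arXiv:2306.15586 — 4 statements merged into one kernel-verified Lean document; each statement's English description precedes it below -/
import Mathlib

section
/- Let Φ be a C¹ symplectic twist diffeomorphism of ℝ^{2d} with Φ − id uniformly bounded. Then there exists a C² function W : ℝ^{2d} → ℝ such that ∇W = Φ̃, i.e. ∂W/∂Q(Q,p) = P̂(Q,p) and ∂W/∂p(Q,p) = q̂(Q,p) for all (Q,p). Moreover, if w(Q,p) := W(Q,p) − Q·p, then sup_{(Q,p)} |∇w(Q,p)| ≤ sup_x |Φ(x) − x|. -/
open MeasureTheory Filter
open scoped ENNReal NNReal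

noncomputable section

/-- Phase space ℝ^d × ℝ^d. -/
abbrev Pd (d : ℕ) := (Fin d → ℝ) × (Fin d → ℝ)

/-- Euclidean dot product on ℝ^d × ℝ^d. -/
def edot {d : ℕ} (x y : Pd d) : ℝ := ∑ i, x.1 i * y.1 i + ∑ i, x.2 i * y.2 i

/-- Euclidean norm on ℝ^d × ℝ^d. -/
def enorm' {d : ℕ} (x : Pd d) : ℝ := Real.sqrt (edot x x)

/-- Surface area of the unit sphere in ℝ^n. -/
def sphereArea (n : ℕ) : ℝ := n * (volume (Metric.ball (0 : EuclideanSpace ℝ (Fin n)) 1)).toReal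

/-- The kernel L. -/
def Lkern (d : ℕ) (x : Pd d) : ℝ :=
  if d = 1 then -(2 * Real.pi)⁻¹ * Real.log (enorm' x)
  else ((2 * d : ℝ) * sphereArea (2 * d))⁻¹ * enorm' x ^ ((2 : ℝ) - (2 * d : ℝ))

def symplForm {d : ℕ} (u v : Pd d) : ℝ := ∑ i, (u.2 i * v.1 i - v.2 i * u.1 i)

def IsCDiffeo {E F : Type*} [NormedAddCommGroup E] [NormedSpace ℝ E]
    [NormedAddCommGroup F] [NormedSpace ℝ F] (k : ℕ∞) (f : E → F) : Prop :=
  ContDiff ℝ k f ∧ Function.Bijective f ∧ ContDiff ℝ k (Function.invFun f)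

def IsSymplectic {d : ℕ} (Φ : Pd d → Pd d) : Prop :=
  ∀ x u v, symplForm (fderiv ℝ Φ x u) (fderiv ℝ Φ x v) = symplForm u v

def IsTwist {d : ℕ} (Φ : Pd d → Pd d) : Prop :=
  ∀ p : Fin d → ℝ, IsCDiffeo 1 (fun q => (Φ (q, p)).1)

def SymplecticTwist {d : ℕ} (k : ℕ∞) (Φ : Pd d → Pd d) : Prop :=
  IsCDiffeo k Φ ∧ IsSymplectic Φ ∧ IsTwist Φ

def qhat {d : ℕ} (Φ : Pd d → Pd d) (z : Pd d) : Fin d → ℝ :=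
  Function.invFun (fun q => (Φ (q, z.2)).1) z.1

def Phat {d : ℕ} (Φ : Pd d → Pd d) (z : Pd d) : Fin d → ℝ :=
  (Φ (qhat Φ z, z.2)).2


def hatMap {d : ℕ} (Φ : Pd d → Pd d) (z : Pd d) : Pd d := (qhat Φ z, Phat Φ z)

/-- The gradient of a scalar function on ℝ^d × ℝ^d, as a point of ℝ^d × ℝ^d. -/
def gradPd {d : ℕ} (f : Pd d → ℝ) (z : Pd d) : Pd d :=
  ((fun i => fderiv ℝ f z ((Pi.single i 1 : Fin d → ℝ), 0)),
   (fun i => fderiv ℝ f z (0, (Pi.single i 1 : Fin d → ℝ))))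

/-- A global inverse of a `C^n` map with injective derivatives, `n ≠ 0`, is `C^n`. -/
theorem contDiff_of_inverse_of_injective_fderiv {E : Type*} [NormedAddCommGroup E]
    [NormedSpace ℝ E] [FiniteDimensional ℝ E] {n : WithTop ℕ∞} {f g : E → E} (hn : n ≠ 0)
    (hf : ContDiff ℝ n f) (hinj : ∀ x, Function.Injective (fderiv ℝ f x))
    (hgf : Function.LeftInverse g f) (hfg : Function.RightInverse g f) : ContDiff ℝ n g := by
  have : CompleteSpace E := FiniteDimensional.complete ℝ E
  rw [contDiff_iff_contDiffAt]
  intro y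
  obtain ⟨x, rfl⟩ := hfg.surjective y
  let e : E ≃L[ℝ] E :=
    (LinearEquiv.ofInjectiveEndo (fderiv ℝ f x : E →ₗ[ℝ] E) (hinj x)).toContinuousLinearEquiv
  have he : HasFDerivAt f (e : E →L[ℝ] E) x := by
    have h : (e : E →L[ℝ] E) = fderiv ℝ f x := by ext v; rfl
    rw [h]
    exact (hf.differentiable hn x).hasFDerivAt
  refine (hf.contDiffAt.to_localInverse he hn).congr_of_eventuallyEq ?_
  exact (hf.contDiffAt.hasStrictFDerivAt' he hn).localInverse_unique (.of_forall hgf)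

theorem IsCDiffeo.injective_fderiv {E F : Type*} [NormedAddCommGroup E] [NormedSpace ℝ E]
    [NormedAddCommGroup F] [NormedSpace ℝ F] {k : ℕ∞} (hk : k ≠ 0) {f : E → F}
    (hf : IsCDiffeo k f) (x : E) : Function.Injective (fderiv ℝ f x) := by
  have hk' : (k : WithTop ℕ∞) ≠ 0 := by exact_mod_cast hk
  have h := (hf.2.2.differentiable hk' (f x)).hasFDerivAt.comp x
    (hf.1.differentiable hk' x).hasFDerivAt
  rw [show Function.invFun f ∘ f = id from
    funext (Function.leftInverse_invFun hf.2.1.injective)] at h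
  have h2 := h.unique (hasFDerivAt_id x)
  exact Function.LeftInverse.injective (g := fderiv ℝ (Function.invFun f) (f x))
    fun v => DFunLike.congr_fun h2 v

section Twist

variable {d : ℕ} {Φ : Pd d → Pd d}

theorem IsTwist.qhat_apply (h : IsTwist Φ) (q p : Fin d → ℝ) :
    qhat Φ ((Φ (q, p)).1, p) = q :=
  Function.leftInverse_invFun (h p).2.1.injective q

theorem IsTwist.fst_apply_qhat (h : IsTwist Φ) (z : Pd d) : (Φ (qhat Φ z, z.2)).1 = z.1 :=
  Function.rightInverse_invFun (h z.2).2.1.surjective z.1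

theorem IsTwist.contDiff_qhat (h : IsTwist Φ) (hΦ : ContDiff ℝ 1 Φ) :
    ContDiff ℝ 1 (qhat Φ) := by
  have hG : ContDiff ℝ 1 (fun x : Pd d => ((Φ x).1, x.2)) :=
    (contDiff_fst.comp hΦ).prodMk contDiff_snd
  have hH : ContDiff ℝ 1 (fun z : Pd d => (qhat Φ z, z.2)) := by
    refine contDiff_of_inverse_of_injective_fderiv one_ne_zero hG (fun x => ?_)
      (fun x => Prod.ext (h.qhat_apply x.1 x.2) rfl)
      (fun z => Prod.ext (h.fst_apply_qhat z) rfl)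
    have hdΦ := (hΦ.differentiable one_ne_zero x).hasFDerivAt
    have hG' := hdΦ.fst.prodMk (hasFDerivAt_snd (p := x))
    have hq : HasFDerivAt (fun q => (Φ (q, x.2)).1) _ x.1 :=
      (HasFDerivAt.comp (f := fun q => (q, x.2)) x.1 hdΦ (hasFDerivAt_prodMk_left x.1 x.2)).fst
    have hinj := (h x.2).injective_fderiv one_ne_zero x.1
    rw [hq.fderiv] at hinj
    rw [hG'.fderiv, injective_iff_map_eq_zero]
    rintro ⟨u, v⟩ huv
    obtain ⟨h1, h2⟩ := Prod.ext_iff.mp huv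
    obtain rfl : v = 0 := h2
    have hu : u = 0 := (injective_iff_map_eq_zero _).mp hinj u h1
    rw [hu, Prod.mk_zero_zero]
  exact contDiff_fst.comp hH

theorem IsTwist.contDiff_Phat (h : IsTwist Φ) (hΦ : ContDiff ℝ 1 Φ) :
    ContDiff ℝ 1 (Phat Φ) :=
  contDiff_snd.comp (hΦ.comp ((h.contDiff_qhat hΦ).prodMk contDiff_snd))

/-- Symplecticity of `Φ`, read in the mixed variables `(Q, p)`. -/
theorem IsSymplectic.sum_fderiv_hat_comm (hs : IsSymplectic Φ) (ht : IsTwist Φ)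
    (hΦ : ContDiff ℝ 1 Φ) (z a b : Pd d) :
    ∑ i, (fderiv ℝ (Phat Φ) z a i * b.1 i + fderiv ℝ (qhat Φ) z a i * b.2 i) =
      ∑ i, (fderiv ℝ (Phat Φ) z b i * a.1 i + fderiv ℝ (qhat Φ) z b i * a.2 i) := by
  have hq := ((ht.contDiff_qhat hΦ).differentiable one_ne_zero z).hasFDerivAt
  have hP := ((ht.contDiff_Phat hΦ).differentiable one_ne_zero z).hasFDerivAt
  have hH := hq.prodMk (hasFDerivAt_snd (p := z))
  have hΦH := HasFDerivAt.comp (f := fun y : Pd d => (qhat Φ y, y.2)) z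
    (hΦ.differentiable one_ne_zero _).hasFDerivAt hH
  have hQP : HasFDerivAt (fun y => (y.1, Phat Φ y)) _ z := (hasFDerivAt_fst (p := z)).prodMk hP
  rw [show Φ ∘ (fun y : Pd d => (qhat Φ y, y.2)) = fun y => (y.1, Phat Φ y) from
    funext fun y => Prod.ext (ht.fst_apply_qhat y) rfl] at hΦH
  have key (c : Pd d) : fderiv ℝ Φ (qhat Φ z, z.2) (fderiv ℝ (qhat Φ) z c, c.2) =
      (c.1, fderiv ℝ (Phat Φ) z c) := DFunLike.congr_fun (hΦH.unique hQP) c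
  have h := hs (qhat Φ z, z.2) (fderiv ℝ (qhat Φ) z a, a.2) (fderiv ℝ (qhat Φ) z b, b.2)
  rw [key, key] at h
  simp only [symplForm, Finset.sum_sub_distrib] at h
  simp only [Finset.sum_add_distrib, mul_comm (fderiv ℝ (qhat Φ) z _ _)]
  linarith

end Twist

/-- The dot product `edot` as a continuous bilinear form. -/
def pairing (d : ℕ) : Pd d →L[ℝ] Pd d →L[ℝ] ℝ :=
  LinearMap.toContinuousLinearMap
    (LinearMap.toContinuousLinearMap.toLinearMap ∘ₗ
      LinearMap.mk₂ ℝ (fun x y : Pd d => ∑ i, (x.1 i * y.1 i + x.2 i * y.2 i))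
        (fun x x' y => by
          rw [← Finset.sum_add_distrib]; congr! 1; simp; ring)
        (fun c x y => by
          simp only [Prod.smul_fst, Prod.smul_snd, Pi.smul_apply, smul_eq_mul, Finset.mul_sum]
          congr! 1; ring)
        (fun x y y' => by
          rw [← Finset.sum_add_distrib]; congr! 1; simp; ring)
        (fun c x y => by
          simp only [Prod.smul_fst, Prod.smul_snd, Pi.smul_apply, smul_eq_mul, Finset.mul_sum]
          congr! 1; ring))

theorem pairing_apply {d : ℕ} (x y : Pd d) :
    pairing d x y = ∑ i, (x.1 i * y.1 i + x.2 i * y.2 i) := rfl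

/-- Every C¹ symplectic twist diffeomorphism `Φ` of ℝ^{2d} with bounded
displacement admits a C² generating function `W` with `∂W/∂Q = P̂`, `∂W/∂p = q̂`; moreover
for `w(Q,p) := W(Q,p) − Q·p` one has `sup |∇w| ≤ sup |Φ − id|`. -/
theorem exists_generating_function {d : ℕ} (Φ : Pd d → Pd d)
    (hΦ : SymplecticTwist 1 Φ)
    (hbdd : ∃ c : ℝ, ∀ x, enorm' (Φ x - x) ≤ c) :
    ∃ W : Pd d → ℝ, ContDiff ℝ 2 W ∧
      (∀ z : Pd d, ∀ i : Fin d,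
        fderiv ℝ W z ((Pi.single i 1 : Fin d → ℝ), 0) = Phat Φ z i ∧
        fderiv ℝ W z (0, (Pi.single i 1 : Fin d → ℝ)) = qhat Φ z i) ∧
      (∀ c : ℝ, (∀ x, enorm' (Φ x - x) ≤ c) →
        ∀ z : Pd d, enorm' (gradPd (fun y => W y - ∑ i, y.1 i * y.2 i) z) ≤ c) := by
  obtain ⟨⟨hC, -, -⟩, hs, ht⟩ := hΦ
  have hC : ContDiff ℝ 1 Φ := hC
  have hq := ht.contDiff_qhat hC
  have hP := ht.contDiff_Phat hC
  let ω : Pd d → Pd d →L[ℝ] ℝ := fun z => pairing d (Phat Φ z, qhat Φ z)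
  have hω : ContDiff ℝ 1 ω := (pairing d).contDiff.comp (hP.prodMk hq)
  have hdω (z a b : Pd d) : fderiv ℝ ω z a b = fderiv ℝ ω z b a := by
    have h : HasFDerivAt ω _ z := (pairing d).hasFDerivAt.comp z
      ((hP.differentiable one_ne_zero z).hasFDerivAt.prodMk
        (hq.differentiable one_ne_zero z).hasFDerivAt)
    rw [h.fderiv]
    exact hs.sum_fderiv_hat_comm ht hC z a b
  obtain ⟨W, hW⟩ := Convex.exists_forall_hasFDerivAt_of_fderiv_symmetric convex_univ
    isOpen_univ (hω.differentiable one_ne_zero).differentiableOn (fun z _ => hdω z)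
  replace hW (z : Pd d) : HasFDerivAt W (ω z) z := hW z (Set.mem_univ z)
  refine ⟨W, ?_, fun z i => ?_, fun c hc z => ?_⟩
  · exact contDiff_succ_iff_hasFDerivAt.mpr ⟨ω, hω, hW⟩
  · rw [(hW z).fderiv]
    simp [ω, pairing_apply, Pi.single_apply]
  · have hdot : HasFDerivAt (fun y : Pd d => ∑ i, y.1 i * y.2 i) (pairing d (z.2, z.1)) z := by
      have h (i : Fin d) : HasFDerivAt (fun y : Pd d => y.1 i * y.2 i) _ z :=
        (hasFDerivAt_pi'.mp (hasFDerivAt_fst (𝕜 := ℝ) (p := z)) i).mul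
          (hasFDerivAt_pi'.mp (hasFDerivAt_snd (𝕜 := ℝ) (p := z)) i)
      refine (HasFDerivAt.fun_sum fun i _ => h i).congr_fderiv ?_
      refine ContinuousLinearMap.ext fun y => ?_
      simp [pairing_apply, add_comm]
    have hgrad : gradPd (fun y => W y - ∑ i, y.1 i * y.2 i) z =
        (Phat Φ z - z.2, qhat Φ z - z.1) := by
      refine Prod.ext (funext fun i => ?_) (funext fun i => ?_) <;>
        simp [gradPd, ((hW z).fun_sub hdot).fderiv, ω, pairing_apply, Pi.single_apply]
    have hΦz : Φ (qhat Φ z, z.2) = (z.1, Phat Φ z) := Prod.ext (ht.fst_apply_qhat z) rfl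
    refine le_of_eq_of_le ?_ (hc (qhat Φ z, z.2))
    rw [hgrad, hΦz, enorm', enorm', edot, edot, add_comm]
    congr! 3
    all_goals
      simp
      ring
end
end

section
/- Let w : ℝ^{2d} → ℝ be a C² function with sup_{(Q,p)} ‖D²w(Q,p)‖ < 1 (operator norm of the Hessian), and set W(Q,p) = Q·p + w(Q,p). Then there exists a symplectic twist diffeomorphism Φ of ℝ^{2d} such that Φ(W_p(Q,p), p) = (Q, W_Q(Q,p)) for all (Q,p) ∈ ℝ^d × ℝ^d, where W_p = ∂W/∂p and W_Q = ∂W/∂Q. -/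
open MeasureTheory Filter
open scoped ENNReal NNReal

noncomputable section

/-- A pair of mutually inverse `C^k` maps consists of `C^k` diffeomorphisms. -/
theorem Equiv.isCDiffeo {E F : Type*} [NormedAddCommGroup E] [NormedSpace ℝ E]
    [NormedAddCommGroup F] [NormedSpace ℝ F] {k : ℕ∞} (e : E ≃ F)
    (he : ContDiff ℝ k e) (he' : ContDiff ℝ k e.symm) : IsCDiffeo k e := by
  refine ⟨he, e.bijective, ?_⟩
  rwa [Function.invFun_eq_of_injective_of_rightInverse e.injective e.right_inv]

/-- A perturbation of the identity by a `C^k` map, `k ≥ 1`, whose derivative is uniformly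
smaller than `1` is a `C^k` diffeomorphism. -/
theorem exists_equiv_id_add_of_norm_fderiv_le {E : Type*} [NormedAddCommGroup E]
    [NormedSpace ℝ E] [CompleteSpace E] {k : WithTop ℕ∞} (hk : k ≠ 0) {f : E → E}
    (hf : ContDiff ℝ k f) {c : ℝ} (hc : c < 1) (hfc : ∀ x, ‖fderiv ℝ f x‖ ≤ c) :
    ∃ e : E ≃ E, (∀ x, e x = x + f x) ∧ ContDiff ℝ k e ∧ ContDiff ℝ k e.symm := by
  lift c to ℝ≥0 using (norm_nonneg _).trans (hfc 0)
  have hdf : Differentiable ℝ f := hf.differentiable hk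
  have hlip : LipschitzWith c f := lipschitzWith_of_nnnorm_fderiv_le hdf fun x => hfc x
  have happ : ApproximatesLinearOn (fun x => x + f x)
      ((ContinuousLinearEquiv.refl ℝ E : E ≃L[ℝ] E) : E →L[ℝ] E) Set.univ c := by
    rw [ApproximatesLinearOn.approximatesLinearOn_iff_lipschitzOnWith, lipschitzOnWith_univ]
    convert hlip using 1
    ext x
    simp
  have hcN : Subsingleton E ∨ c <
      ‖((ContinuousLinearEquiv.refl ℝ E).symm : E →L[ℝ] E)‖₊⁻¹ := by
    rcases subsingleton_or_nontrivial E with h | h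
    · exact Or.inl h
    · right
      have : ‖((ContinuousLinearEquiv.refl ℝ E).symm : E →L[ℝ] E)‖₊ = 1 :=
        NNReal.eq (ContinuousLinearMap.norm_id (𝕜 := ℝ) (E := E))
      rw [this, inv_one]
      exact_mod_cast hc
  let e : E ≃ₜ E := happ.toHomeomorph _ hcN
  have hsmooth : ContDiff ℝ k e := contDiff_id.add hf
  let e' (x : E) : E ≃L[ℝ] E := ContinuousLinearEquiv.unitsEquiv ℝ E
    (Units.oneSub (-fderiv ℝ f x) (by rw [norm_neg]; exact (hfc x).trans_lt hc))
  refine ⟨e.toEquiv, fun x => rfl, hsmooth, e.contDiff_symm (f₀' := e') (fun x => ?_) hsmooth⟩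
  have he' : (e' x : E →L[ℝ] E) = ContinuousLinearMap.id ℝ E + fderiv ℝ f x := by
    ext v
    simp [e']
  rw [he']
  exact (hasFDerivAt_id x).add (hdf x).hasFDerivAt

/-- The momentum components of a covector, placed in the position slot. -/
def momentumPart (d : ℕ) : (Pd d →L[ℝ] ℝ) →L[ℝ] Pd d :=
  LinearMap.mkContinuous
    { toFun := fun φ => (fun i => φ (0, Pi.single i 1), 0)
      map_add' := fun φ ψ => by ext <;> simp
      map_smul' := fun a φ => by ext <;> simp }
    1 fun φ => by
      simp only [LinearMap.coe_mk, AddHom.coe_mk, one_mul, Prod.norm_mk, norm_zero,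
        sup_le_iff, norm_nonneg, and_true]
      refine (pi_norm_le_iff_of_nonneg (norm_nonneg φ)).2 fun i => ?_
      refine φ.unit_le_opNorm _ ?_
      simp [Prod.norm_mk, Pi.norm_single]

/-- The position components of a covector, placed in the momentum slot. -/
def positionPart (d : ℕ) : (Pd d →L[ℝ] ℝ) →L[ℝ] Pd d :=
  LinearMap.mkContinuous
    { toFun := fun φ => (0, fun i => φ (Pi.single i 1, 0))
      map_add' := fun φ ψ => by ext <;> simp
      map_smul' := fun a φ => by ext <;> simp }
    1 fun φ => by
      simp only [LinearMap.coe_mk, AddHom.coe_mk, one_mul, Prod.norm_mk, norm_zero,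
        sup_le_iff, norm_nonneg, true_and]
      refine (pi_norm_le_iff_of_nonneg (norm_nonneg φ)).2 fun i => ?_
      refine φ.unit_le_opNorm _ ?_
      simp [Prod.norm_mk, Pi.norm_single]

theorem momentumPart_apply {d : ℕ} (φ : Pd d →L[ℝ] ℝ) :
    momentumPart d φ = (fun i => φ (0, Pi.single i 1), 0) := rfl

theorem positionPart_apply {d : ℕ} (φ : Pd d →L[ℝ] ℝ) :
    positionPart d φ = (0, fun i => φ (Pi.single i 1, 0)) := rfl

theorem norm_momentumPart_le (d : ℕ) : ‖momentumPart d‖ ≤ 1 :=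
  LinearMap.mkContinuous_norm_le _ zero_le_one _

theorem norm_positionPart_le (d : ℕ) : ‖positionPart d‖ ≤ 1 :=
  LinearMap.mkContinuous_norm_le _ zero_le_one _

theorem sum_mul_apply_single {ι : Type*} [Fintype ι] [DecidableEq ι] (φ : (ι → ℝ) →L[ℝ] ℝ)
    (a : ι → ℝ) : ∑ i, a i * φ (Pi.single i 1) = φ a := by
  conv_rhs => rw [← Finset.univ_sum_single a, map_sum]
  refine Finset.sum_congr rfl fun i _ => ?_
  rw [← smul_eq_mul, ← map_smul, ← Pi.single_smul, smul_eq_mul, mul_one]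

theorem sum_mul_apply_momentum_single {d : ℕ} (φ : Pd d →L[ℝ] ℝ) (a : Fin d → ℝ) :
    ∑ i, a i * φ (0, Pi.single i 1) = φ (0, a) :=
  sum_mul_apply_single (φ.comp (ContinuousLinearMap.inr ℝ (Fin d → ℝ) (Fin d → ℝ))) a

theorem sum_mul_apply_position_single {d : ℕ} (φ : Pd d →L[ℝ] ℝ) (a : Fin d → ℝ) :
    ∑ i, a i * φ (Pi.single i 1, 0) = φ (a, 0) :=
  sum_mul_apply_single (φ.comp (ContinuousLinearMap.inl ℝ (Fin d → ℝ) (Fin d → ℝ))) a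

/-- For a symmetric bilinear form `B`, the linearizations `1 + momentumPart ∘ B` and
`1 + positionPart ∘ B` pull the symplectic form back to the same form. -/
theorem symplForm_add_positionPart {d : ℕ} (B : Pd d →L[ℝ] Pd d →L[ℝ] ℝ)
    (hB : ∀ u v, B u v = B v u) (u v : Pd d) :
    symplForm (u + positionPart d (B u)) (v + positionPart d (B v)) =
      symplForm (u + momentumPart d (B u)) (v + momentumPart d (B v)) := by
  have split (x y : Pd d) : B x y = B x (y.1, 0) + B x (0, y.2) := by
    rw [← map_add]; simp
  have h1 : symplForm (u + positionPart d (B u)) (v + positionPart d (B v)) =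
      symplForm u v + (B u (v.1, 0) - B v (u.1, 0)) := by
    rw [← sum_mul_apply_position_single, ← sum_mul_apply_position_single]
    simp only [symplForm, ← Finset.sum_sub_distrib, ← Finset.sum_add_distrib]
    refine Finset.sum_congr rfl fun i _ => ?_
    simp [positionPart_apply]
    ring
  have h2 : symplForm (u + momentumPart d (B u)) (v + momentumPart d (B v)) =
      symplForm u v + (B v (0, u.2) - B u (0, v.2)) := by
    rw [← sum_mul_apply_momentum_single, ← sum_mul_apply_momentum_single]
    simp only [symplForm, ← Finset.sum_sub_distrib, ← Finset.sum_add_distrib]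
    refine Finset.sum_congr rfl fun i _ => ?_
    simp [momentumPart_apply]
    ring
  rw [h1, h2]
  linarith [hB u v, split u v, split v u]

theorem hasFDerivAt_id_add_comp_fderiv {d : ℕ} {w : Pd d → ℝ} (hw : ContDiff ℝ 2 w)
    (L : (Pd d →L[ℝ] ℝ) →L[ℝ] Pd d) (z : Pd d) :
    HasFDerivAt (fun y => y + L (fderiv ℝ w y))
      (ContinuousLinearMap.id ℝ (Pd d) + L.comp (fderiv ℝ (fderiv ℝ w) z)) z := by
  have hdw : ContDiff ℝ 1 (fderiv ℝ w) := hw.fderiv_right (by norm_num)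
  exact (hasFDerivAt_id z).add
    (L.hasFDerivAt.comp z (hdw.differentiable one_ne_zero z).hasFDerivAt)

theorem exists_equiv_id_add_comp_fderiv {d : ℕ} {w : Pd d → ℝ} (hw : ContDiff ℝ 2 w)
    {c : ℝ} (hc : c < 1) (hwc : ∀ z, ‖fderiv ℝ (fderiv ℝ w) z‖ ≤ c)
    {L : (Pd d →L[ℝ] ℝ) →L[ℝ] Pd d} (hL : ‖L‖ ≤ 1) :
    ∃ e : Pd d ≃ Pd d, (∀ z, e z = z + L (fderiv ℝ w z)) ∧
      ContDiff ℝ 1 e ∧ ContDiff ℝ 1 e.symm := by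
  have hdw : ContDiff ℝ 1 (fderiv ℝ w) := hw.fderiv_right (by norm_num)
  refine exists_equiv_id_add_of_norm_fderiv_le one_ne_zero (L.contDiff.comp hdw) hc fun z => ?_
  have hz : HasFDerivAt (fun y => L (fderiv ℝ w y)) (L.comp (fderiv ℝ (fderiv ℝ w) z)) z :=
    L.hasFDerivAt.comp z (hdw.differentiable one_ne_zero z).hasFDerivAt
  calc ‖fderiv ℝ (fun y => L (fderiv ℝ w y)) z‖
      = ‖L.comp (fderiv ℝ (fderiv ℝ w) z)‖ := by rw [hz.fderiv]
    _ ≤ ‖L‖ * ‖fderiv ℝ (fderiv ℝ w) z‖ := L.opNorm_comp_le _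
    _ ≤ 1 * c := mul_le_mul hL (hwc z) (ContinuousLinearMap.opNorm_nonneg _) zero_le_one
    _ = c := one_mul c

theorem fderiv_sum_mul_add {d : ℕ} {w : Pd d → ℝ} (hw : Differentiable ℝ w) (z v : Pd d) :
    fderiv ℝ (fun y : Pd d => ∑ j, y.1 j * y.2 j + w y) z v =
      ∑ j, (z.1 j * v.2 j + z.2 j * v.1 j) + fderiv ℝ w z v := by
  have h1 (j : Fin d) : HasFDerivAt (fun y : Pd d => y.1 j)
      ((ContinuousLinearMap.proj j).comp (ContinuousLinearMap.fst ℝ (Fin d → ℝ) (Fin d → ℝ))) z :=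
    ((ContinuousLinearMap.proj (R := ℝ) (φ := fun _ : Fin d => ℝ) j).comp
      (ContinuousLinearMap.fst ℝ (Fin d → ℝ) (Fin d → ℝ))).hasFDerivAt
  have h2 (j : Fin d) : HasFDerivAt (fun y : Pd d => y.2 j)
      ((ContinuousLinearMap.proj j).comp (ContinuousLinearMap.snd ℝ (Fin d → ℝ) (Fin d → ℝ))) z :=
    ((ContinuousLinearMap.proj (R := ℝ) (φ := fun _ : Fin d => ℝ) j).comp
      (ContinuousLinearMap.snd ℝ (Fin d → ℝ) (Fin d → ℝ))).hasFDerivAt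
  have h := (HasFDerivAt.fun_sum (u := Finset.univ) fun j _ => (h1 j).fun_mul (h2 j)).fun_add
    (hw z).hasFDerivAt
  rw [h.fderiv]
  simp

/-- If `w` is C² with `sup ‖D²w‖ < 1` and `W(Q,p) = Q·p + w(Q,p)`, then
there is a symplectic twist diffeomorphism `Φ` with `Φ(W_p(Q,p), p) = (Q, W_Q(Q,p))`. -/
theorem generating_function_produces_twist_map {d : ℕ} (w : Pd d → ℝ)
    (hw : ContDiff ℝ 2 w)
    (hsmall : ∃ c : ℝ, c < 1 ∧ ∀ z : Pd d, ‖fderiv ℝ (fun y => fderiv ℝ w y) z‖ ≤ c) :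
    ∃ Φ : Pd d → Pd d, SymplecticTwist 1 Φ ∧
      ∀ Q p : Fin d → ℝ,
        Φ ((fun i => fderiv ℝ (fun y : Pd d => ∑ j, y.1 j * y.2 j + w y) (Q, p)
              (0, (Pi.single i 1 : Fin d → ℝ))), p)
          = (Q, fun i => fderiv ℝ (fun y : Pd d => ∑ j, y.1 j * y.2 j + w y) (Q, p)
              ((Pi.single i 1 : Fin d → ℝ), 0)) := by
  obtain ⟨c, hc, hwc⟩ := hsmall
  have hdw : Differentiable ℝ w := hw.differentiable two_ne_zero
  obtain ⟨F, hF, hFs, hFs'⟩ := exists_equiv_id_add_comp_fderiv hw hc hwc (norm_momentumPart_le d)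
  obtain ⟨G, hG, hGs, hGs'⟩ := exists_equiv_id_add_comp_fderiv hw hc hwc (norm_positionPart_le d)
  have hF2 (z : Pd d) : (F z).2 = z.2 := by simp [hF, momentumPart_apply]
  have hF2' (z : Pd d) : (F.symm z).2 = z.2 := by rw [← hF2, F.apply_symm_apply]
  have hG1 (z : Pd d) : (G z).1 = z.1 := by simp [hG, positionPart_apply]
  refine ⟨F.symm.trans G, ⟨(F.symm.trans G).isCDiffeo (hGs.comp hFs') (hFs.comp hGs'),
    fun x u v => ?_, fun p => ?_⟩, fun Q p => ?_⟩
  · have hDF : HasFDerivAt F (ContinuousLinearMap.id ℝ (Pd d) +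
        (momentumPart d).comp (fderiv ℝ (fderiv ℝ w) (F.symm x))) (F.symm x) := by
      rw [funext hF]
      exact hasFDerivAt_id_add_comp_fderiv hw (momentumPart d) (F.symm x)
    have hDG : HasFDerivAt G (ContinuousLinearMap.id ℝ (Pd d) +
        (positionPart d).comp (fderiv ℝ (fderiv ℝ w) (F.symm x))) (F.symm x) := by
      rw [funext hG]
      exact hasFDerivAt_id_add_comp_fderiv hw (positionPart d) (F.symm x)
    have hDF' : HasFDerivAt F.symm (fderiv ℝ F.symm x) x :=
      (hFs'.differentiable one_ne_zero x).hasFDerivAt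
    have hid : HasFDerivAt (F ∘ F.symm) (ContinuousLinearMap.id ℝ (Pd d)) x := by
      rw [F.self_comp_symm]
      exact hasFDerivAt_id x
    have hinv (t : Pd d) := DFunLike.congr_fun ((hDF.comp x hDF').unique hid) t
    have hΦ : HasFDerivAt (F.symm.trans G) _ x := hDG.comp x hDF'
    have hsymm : ∀ a b, fderiv ℝ (fderiv ℝ w) (F.symm x) a b =
        fderiv ℝ (fderiv ℝ w) (F.symm x) b a :=
      (hw.contDiffAt.isSymmSndFDerivAt (by simp)).eq
    have hpull := symplForm_add_positionPart _ hsymm (fderiv ℝ F.symm x u) (fderiv ℝ F.symm x v)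
    have hu := hinv u
    have hv := hinv v
    simp only [ContinuousLinearMap.comp_apply, add_apply,
      ContinuousLinearMap.id_apply] at hu hv
    rw [hu, hv] at hpull
    rw [hΦ.fderiv]
    exact hpull
  · let e : (Fin d → ℝ) ≃ (Fin d → ℝ) :=
      { toFun := fun q => (F.symm (q, p)).1
        invFun := fun Q => (F (Q, p)).1
        left_inv := fun q => by
          have h : ((F.symm (q, p)).1, p) = F.symm (q, p) := Prod.ext rfl (hF2' (q, p)).symm
          simp only [h, F.apply_symm_apply]
        right_inv := fun Q => by
          have h : ((F (Q, p)).1, p) = F (Q, p) := Prod.ext rfl (hF2 (Q, p)).symm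
          simp only [h, F.symm_apply_apply] }
    have hincl : ContDiff ℝ 1 fun q : Fin d → ℝ => (q, p) := contDiff_id.prodMk contDiff_const
    have he : (fun q => ((F.symm.trans G) (q, p)).1) = e := funext fun q => hG1 _
    rw [he]
    exact e.isCDiffeo (contDiff_fst.comp (hFs'.comp hincl)) (contDiff_fst.comp (hFs.comp hincl))
  · have hFQ : F (Q, p) = (fun i => fderiv ℝ (fun y : Pd d => ∑ j, y.1 j * y.2 j + w y) (Q, p)
        (0, (Pi.single i 1 : Fin d → ℝ)), p) := by
      rw [hF, momentumPart_apply]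
      ext i <;> simp [fderiv_sum_mul_add hdw, Pi.single_apply]
    rw [← hFQ, Equiv.trans_apply, F.symm_apply_apply, hG, positionPart_apply]
    ext i <;> simp [fderiv_sum_mul_add hdw, Pi.single_apply]
end
end

section
/- Let η denote matrix inversion, η(Z) = Z⁻¹, on the open set of invertible d×d real matrices. For every invertible Z, the Fréchet derivative Dη(Z) (which is the linear map V ↦ −Z⁻¹VZ⁻¹ on ℝ^{d×d}) satisfies |det Dη(Z)| = |det Z|^{−2d}. Consequently, for every measurable set S of invertible d×d matrices, the Lebesgue volume of η(S) = {Z⁻¹ : Z ∈ S} equals ∫_S |det Z|^{−2d} dZ. -/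
open MeasureTheory

noncomputable section

attribute [local instance] Matrix.normedAddCommGroup Matrix.normedSpace

/-- Lebesgue measure on d×d matrices (product Lebesgue measure over the entries). -/
instance matrixMeasureSpace {d : ℕ} : MeasureSpace (Matrix (Fin d) (Fin d) ℝ) :=
  inferInstanceAs (MeasureSpace (Fin d → Fin d → ℝ))

/-- The linear map `V ↦ −Z⁻¹ V Z⁻¹`, the derivative of matrix inversion at `Z`. -/
def invDeriv {d : ℕ} (Z : Matrix (Fin d) (Fin d) ℝ) :
    Matrix (Fin d) (Fin d) ℝ →ₗ[ℝ] Matrix (Fin d) (Fin d) ℝ :=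
  -((LinearMap.mulLeft ℝ Z⁻¹).comp (LinearMap.mulRight ℝ Z⁻¹))

theorem toMatrix_stdBasis_mulLeft_comp_mulRight {R n : Type*} [CommRing R] [Fintype n]
    [DecidableEq n] (A B : Matrix n n R) :
    LinearMap.toMatrix (Matrix.stdBasis R n n) (Matrix.stdBasis R n n)
      ((LinearMap.mulLeft R A).comp (LinearMap.mulRight R B)) =
    Matrix.kroneckerMap (· * ·) A B.transpose := by
  ext ⟨i, j⟩ ⟨k, l⟩
  have repr_apply (M : Matrix n n R) : (Matrix.stdBasis R n n).repr M (i, j) = M i j := by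
    simp [Matrix.stdBasis]
  rw [LinearMap.toMatrix_apply, Matrix.stdBasis_eq_single, repr_apply]
  simp [Matrix.mul_apply, Matrix.single_apply, ite_and]

theorem abs_det_invDeriv {d : ℕ} (Z : Matrix (Fin d) (Fin d) ℝ) :
    |LinearMap.det (invDeriv Z)| = |Z.det| ^ (-(2 * (d : ℤ))) := by
  rw [invDeriv, ← LinearMap.det_toMatrix (Matrix.stdBasis ℝ (Fin d) (Fin d)), map_neg,
    toMatrix_stdBasis_mulLeft_comp_mulRight, Matrix.det_neg, Matrix.det_kronecker,
    Matrix.det_transpose, Matrix.det_nonsing_inv, Ring.inverse_eq_inv', ← pow_add, abs_mul,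
    abs_pow, abs_neg, abs_one, one_pow, one_mul, abs_pow, abs_inv, inv_pow, zpow_neg,
    Fintype.card_fin, ← two_mul]
  norm_cast

theorem isLittleOTVS_ringInverse {A : Type*} [NormedRing A] [NormedAlgebra ℝ A]
    [FiniteDimensional ℝ A] (u : Aˣ) :
    (fun y : A => Ring.inverse y - Ring.inverse (u : A) -
      -(Ring.inverse (u : A) * ((y - u) * Ring.inverse (u : A))))
      =o[ℝ; nhds (u : A)] (fun y => y - u) := by
  have : CompleteSpace A := FiniteDimensional.complete ℝ A
  simpa [mul_assoc] using
    hasFDerivAt_iff_isLittleOTVS.1 (hasFDerivAt_ringInverse (𝕜 := ℝ) u)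

theorem hasFDerivAt_matrix_inv {d : ℕ} {Z : Matrix (Fin d) (Fin d) ℝ} (hZ : IsUnit Z.det) :
    HasFDerivAt (fun Y : Matrix (Fin d) (Fin d) ℝ => Y⁻¹)
      (LinearMap.toContinuousLinearMap (invDeriv Z)) Z := by
  obtain ⟨u, rfl⟩ := (Matrix.isUnit_iff_isUnit_det Z).2 hZ
  refine hasFDerivAt_iff_isLittleOTVS.2 ?_
  simp only [LinearMap.coe_toContinuousLinearMap', invDeriv, Matrix.nonsing_inv_eq_ringInverse,
    LinearMap.neg_apply, LinearMap.comp_apply, LinearMap.mulLeft_apply, LinearMap.mulRight_apply]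
  exact @isLittleOTVS_ringInverse _ Matrix.linftyOpNormedRing Matrix.linftyOpNormedAlgebra
    (inferInstanceAs (FiniteDimensional ℝ (Matrix (Fin d) (Fin d) ℝ))) u

theorem borelSpace_matrix {d : ℕ} :
    @BorelSpace (Matrix (Fin d) (Fin d) ℝ)
      (Matrix.normedAddCommGroup.toPseudoMetricSpace.toUniformSpace.toTopologicalSpace)
      matrixMeasureSpace.toMeasurableSpace :=
  inferInstanceAs (BorelSpace (Fin d → Fin d → ℝ))

theorem isAddHaarMeasure_volume_matrix {d : ℕ} :
    @Measure.IsAddHaarMeasure (Matrix (Fin d) (Fin d) ℝ) _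
      (Matrix.normedAddCommGroup.toPseudoMetricSpace.toUniformSpace.toTopologicalSpace)
      matrixMeasureSpace.toMeasurableSpace volume := by
  have h : (volume : Measure (Fin d → ℝ)).IsAddHaarMeasure := inferInstance
  exact Measure.pi.isAddHaarMeasure (fun _ : Fin d => (volume : Measure (Fin d → ℝ)))

/-- At each invertible `Z`, matrix inversion `η(Z) = Z⁻¹` has Fréchet
derivative `V ↦ −Z⁻¹VZ⁻¹`, whose determinant has absolute value `|det Z|^{−2d}`;
consequently the Lebesgue volume of `η(S)` equals `∫_S |det Z|^{−2d} dZ` for every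
measurable set `S` of invertible matrices. -/
theorem matrix_inversion_jacobian {d : ℕ} :
    (∀ Z : Matrix (Fin d) (Fin d) ℝ, IsUnit Z.det →
      HasFDerivAt (fun Y : Matrix (Fin d) (Fin d) ℝ => Y⁻¹)
        (LinearMap.toContinuousLinearMap (invDeriv Z)) Z ∧
      |LinearMap.det (invDeriv Z)| = |Z.det| ^ (-(2 * (d : ℤ)))) ∧
    (∀ S : Set (Matrix (Fin d) (Fin d) ℝ), MeasurableSet S →
      (∀ Z ∈ S, IsUnit Z.det) →
      volume ((fun Z : Matrix (Fin d) (Fin d) ℝ => Z⁻¹) '' S)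
        = ∫⁻ Z in S, ENNReal.ofReal (|Z.det| ^ (-(2 * (d : ℤ)))) ∂volume) := by
  refine ⟨fun Z hZ => ⟨hasFDerivAt_matrix_inv hZ, abs_det_invDeriv Z⟩, fun S hS hSu => ?_⟩
  have := borelSpace_matrix (d := d)
  have := isAddHaarMeasure_volume_matrix (d := d)
  have hinj : Set.InjOn (fun Z : Matrix (Fin d) (Fin d) ℝ => Z⁻¹) S := fun Y hY Z hZ h => by
    rw [← Matrix.nonsing_inv_nonsing_inv Y (hSu Y hY),
      ← Matrix.nonsing_inv_nonsing_inv Z (hSu Z hZ)]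
    exact congrArg _ h
  rw [← lintegral_abs_det_fderiv_eq_addHaar_image volume hS
    (fun Z hZ => (hasFDerivAt_matrix_inv (hSu Z hZ)).hasFDerivWithinAt) hinj]
  simp only [LinearMap.det_toContinuousLinearMap, abs_det_invDeriv]
end
end

section
/- Let K : ℝ^N → ℝ^{2d} be continuous and 1-periodic in each coordinate, let A ∈ ℝ^{N×2d}, and suppose that for each ω ∈ 𝕋^N the map Φ(x,ω) := x + K(ω + Ax) is a symplectic twist diffeomorphism of ℝ^{2d}. Then the displacement of the associated map Φ̂ is quasiperiodic with the same frequency matrix: there exists a continuous map γ = (α̂, β̂) : 𝕋^N → ℝ^{2d} (1-periodic in each coordinate) such that Φ̂(x̂, ω) − x̂ = γ(ω + A x̂) for all x̂ = (Q,p) ∈ ℝ^{2d} and all ω ∈ 𝕋^N. -/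
open MeasureTheory Filter
open scoped ENNReal NNReal

noncomputable section

/-- The point of ℝ^{2d} corresponding to `x = (q,p) ∈ ℝ^d × ℝ^d`, as a vector indexed
by `Fin d ⊕ Fin d`. -/
def pvec {d : ℕ} (x : Pd d) : Fin d ⊕ Fin d → ℝ := Sum.elim x.1 x.2

theorem apply_add_intCast_of_periodic_single {ι β : Type*} [Fintype ι] [DecidableEq ι]
    {f : (ι → ℝ) → β} (hf : ∀ x i, f (x + Pi.single i 1) = f x) (x : ι → ℝ) (n : ι → ℤ) :
    f (x + fun i => (n i : ℝ)) = f x := by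
  have key : ∀ s : Finset ι, ∀ x : ι → ℝ,
      f (x + ∑ i ∈ s, n i • (Pi.single i 1 : ι → ℝ)) = f x := by
    intro s
    induction s using Finset.induction_on with
    | empty => simp
    | insert a s ha ih =>
      intro x
      rw [Finset.sum_insert ha, ← add_assoc, ih]
      exact Function.Periodic.zsmul (fun y => hf y a) (n a) x
  rw [← key Finset.univ x]
  congr 2
  ext j
  simp [Finset.sum_apply, Pi.single_apply]

theorem exists_norm_le_of_continuous_of_periodic_single {ι E : Type*} [Fintype ι] [DecidableEq ι]
    [SeminormedAddCommGroup E] {f : (ι → ℝ) → E} (hc : Continuous f)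
    (hf : ∀ x i, f (x + Pi.single i 1) = f x) : ∃ C, ∀ x, ‖f x‖ ≤ C := by
  obtain ⟨C, hC⟩ := (isCompact_Icc (a := (0 : ι → ℝ)) (b := 1)).exists_bound_of_continuousOn
    hc.continuousOn
  refine ⟨C, fun x => ?_⟩
  have hx : (fun i => Int.fract (x i)) + (fun i => (⌊x i⌋ : ℝ)) = x := by
    ext i
    exact Int.fract_add_floor (x i)
  rw [← hx, apply_add_intCast_of_periodic_single hf]
  exact hC _ ⟨fun i => Int.fract_nonneg _, fun i => (Int.fract_lt_one _).le⟩

/-- A function with compactly contained values, implicitly defined as the unique zero of a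
continuous function, is continuous. -/
theorem continuous_of_unique_zero {X Y Z : Type*} [TopologicalSpace X] [TopologicalSpace Y]
    [TopologicalSpace Z] [Zero Z] [T2Space Z] {G : X → Y → Z}
    (hG : Continuous fun z : X × Y => G z.1 z.2) {s : Set Y} (hs : IsCompact s) {f : X → Y}
    (hfs : ∀ x, f x ∈ s) (hf : ∀ x, G x (f x) = 0) (huniq : ∀ x y, G x y = 0 → y = f x) :
    Continuous f := by
  rw [continuous_iff_continuousAt]
  intro x
  refine hs.tendsto_nhds_of_unique_mapClusterPt (Eventually.of_forall hfs) fun y _ hy => ?_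
  obtain ⟨U, hU, hUy⟩ := mapClusterPt_iff_ultrafilter.1 hy
  have hx : Tendsto id (U : Filter X) (nhds x) := hU
  have h := (hG.tendsto (x, y)).comp (hx.prodMk_nhds hUy)
  refine huniq x y (tendsto_nhds_unique h ?_)
  refine tendsto_const_nhds.congr fun t => ?_
  exact (hf t).symm

theorem pvec_add {d : ℕ} (x y : Pd d) : pvec (x + y) = pvec x + pvec y := by
  ext i
  cases i <;> rfl

theorem continuous_pvec {d : ℕ} : Continuous (pvec (d := d)) := by
  refine continuous_pi fun i => ?_
  cases i with
  | inl i => exact (continuous_apply i).comp continuous_fst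
  | inr i => exact (continuous_apply i).comp continuous_snd

theorem qhat_eq_iff {d : ℕ} {Φ : Pd d → Pd d} (hΦ : IsTwist Φ) (z : Pd d) (q : Fin d → ℝ) :
    qhat Φ z = q ↔ (Φ (q, z.2)).1 = z.1 := by
  have hb := (hΦ z.2).2.1
  constructor
  · rintro rfl
    exact Function.rightInverse_invFun hb.2 z.1
  · intro h
    rw [qhat, ← h]
    exact Function.leftInverse_invFun hb.1 q

/-- If `Φ(x,ω) = x + K(ω + Ax)` is a quasiperiodic symplectic twist
diffeomorphism (with `K` continuous and 1-periodic in each coordinate), then the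
displacement of the associated map `Φ̂` is quasiperiodic with the same frequency
matrix: `Φ̂(x̂,ω) − x̂ = γ(ω + Ax̂)` for a continuous 1-periodic `γ`. -/
theorem hat_map_of_quasiperiodic_is_quasiperiodic {d N : ℕ}
    (K : (Fin N → ℝ) → Pd d) (hKcont : Continuous K)
    (hKper : ∀ (ω : Fin N → ℝ) (k : Fin N), K (ω + Pi.single k 1) = K ω)
    (A : Matrix (Fin N) (Fin d ⊕ Fin d) ℝ)
    (Φ : Pd d → (Fin N → ℝ) → Pd d)
    (hΦdef : ∀ x ω, Φ x ω = x + K (ω + A.mulVec (pvec x)))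
    (hST : ∀ ω, SymplecticTwist 1 (fun x => Φ x ω)) :
    ∃ γ : (Fin N → ℝ) → Pd d, Continuous γ ∧
      (∀ (ω : Fin N → ℝ) (k : Fin N), γ (ω + Pi.single k 1) = γ ω) ∧
      ∀ (xhat : Pd d) (ω : Fin N → ℝ),
        hatMap (fun x => Φ x ω) xhat - xhat = γ (ω + A.mulVec (pvec xhat)) := by
  have htw : ∀ ω, IsTwist (fun x => Φ x ω) := fun ω => (hST ω).2.2
  let γ : (Fin N → ℝ) → Pd d := fun ω => hatMap (fun x => Φ x ω) 0
  have hzero : ∀ ω q, qhat (fun x => Φ x ω) 0 = q ↔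
      q + (K (ω + A.mulVec (pvec (q, 0)))).1 = 0 := by
    intro ω q
    rw [qhat_eq_iff (htw ω)]
    simp [hΦdef]
  have hq : Continuous fun ω => qhat (fun x => Φ x ω) (0 : Pd d) := by
    obtain ⟨C, hC⟩ := exists_norm_le_of_continuous_of_periodic_single hKcont hKper
    refine continuous_of_unique_zero
      (G := fun (ω : Fin N → ℝ) (q : Fin d → ℝ) => q + (K (ω + A.mulVec (pvec (q, 0)))).1)
      ?_ (isCompact_closedBall (0 : Fin d → ℝ) C) ?_
      (fun ω => (hzero ω _).1 rfl) (fun ω q h => ((hzero ω q).2 h).symm)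
    · have hp : Continuous fun z : (Fin N → ℝ) × (Fin d → ℝ) => pvec (z.2, (0 : Fin d → ℝ)) :=
        continuous_pvec.comp (by fun_prop)
      have hA : Continuous fun z : (Fin N → ℝ) × (Fin d → ℝ) =>
          A.mulVec (pvec (z.2, (0 : Fin d → ℝ))) := continuous_const.matrix_mulVec hp
      exact continuous_snd.add (continuous_fst.comp (hKcont.comp (continuous_fst.add hA)))
    · intro ω
      rw [mem_closedBall_zero_iff, eq_neg_of_add_eq_zero_left ((hzero ω _).1 rfl), norm_neg]
      exact (norm_fst_le _).trans (hC _)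
  have hperΦ : ∀ ω k, (fun x => Φ x (ω + Pi.single k 1)) = fun x => Φ x ω := by
    intro ω k
    ext1 x
    rw [hΦdef, hΦdef, add_right_comm, hKper]
  refine ⟨γ, ?_, fun ω k => ?_, fun x ω => ?_⟩
  · refine hq.prodMk ?_
    have hA : Continuous fun ω : Fin N → ℝ =>
        A.mulVec (pvec (qhat (fun x => Φ x ω) 0, (0 : Fin d → ℝ))) :=
      continuous_const.matrix_mulVec (continuous_pvec.comp (hq.prodMk continuous_const))
    have h := continuous_snd.comp (hKcont.comp (continuous_id.add hA))
    refine h.congr fun ω => ?_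
    simp [Phat, hΦdef]
  · change hatMap (fun x => Φ x (ω + Pi.single k 1)) 0 = _
    rw [hperΦ]
  · set ω' := ω + A.mulVec (pvec x) with hω'
    set q := qhat (fun x => Φ x ω') 0 with hqdef
    have hq0 := (hzero ω' q).1 hqdef.symm
    have hshift : ω + A.mulVec (pvec (q + x.1, x.2)) = ω' + A.mulVec (pvec (q, 0)) := by
      have : ((q + x.1, x.2) : Pd d) = x + (q, 0) := by
        ext i <;> simp [add_comm]
      rw [this, pvec_add, Matrix.mulVec_add, hω', add_assoc]
    have hqx : qhat (fun x => Φ x ω) x = q + x.1 := by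
      rw [qhat_eq_iff (htw ω)]
      simp only [hΦdef, hshift, Prod.fst_add]
      rw [add_right_comm, hq0, zero_add]
    refine Prod.ext ?_ ?_
    · change qhat (fun x => Φ x ω) x - x.1 = q
      rw [hqx, add_sub_cancel_right]
    · change Phat (fun x => Φ x ω) x - x.2 = Phat (fun x => Φ x ω') 0
      rw [Phat, Phat, hqx, ← hqdef]
      simp only [hΦdef, hshift, Prod.snd_add, Prod.snd_zero, add_sub_cancel_left, zero_add]
end
end
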